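/- Fix 0 < p < 2. The cumulative distribution function Φ_p of the p-stable distribution satisfies 1 − Φ_p(x) = O(x^{−p}) as x → ∞, and the density φ_p satisfies φ_p(x) = O(1/(1+|x|^{p+1})) for all x ∈ ℝ; moreover φ_p is an even function. -/

import Mathlib

open MeasureTheory

lemma sdb_exp_sub_one {z : ℂ} (hz : z.re ≤ 0) : ‖Complex.exp z - 1‖ ≤ 2 * ‖z‖ := by
  by_cases h : ‖z‖ ≤ 1
  · exact Complex.norm_exp_sub_one_le h
  · have h1 : ‖Complex.exp z‖ ≤ 1 := by
      rw [Complex.norm_exp]; exact Real.exp_le_one_iff.2 hz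
    have := norm_sub_le (Complex.exp z) 1
    simp only [norm_one] at this
    linarith

/-- integrand on the ray of angle `y` -/
noncomputable def sdbL (p x y r : ℝ) : ℂ :=
  Complex.exp (Complex.I * y) * Complex.exp (Complex.I * x * r * Complex.exp (Complex.I * y)
    - (r ^ p : ℝ) * Complex.exp (Complex.I * (p * y)))

noncomputable def sdbG (p x : ℝ) (w : ℂ) : ℂ :=
  Complex.exp (w + Complex.I * x * Complex.exp w - Complex.exp (p * w))

lemma sdb_G_eq (p x y u : ℝ) :
    sdbG p x (u + y * Complex.I) = Real.exp u • sdbL p x y (Real.exp u) := by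
  unfold sdbG sdbL
  rw [Complex.real_smul, Complex.ofReal_exp, ← Real.exp_mul, Complex.ofReal_exp,
    ← Complex.exp_add, ← Complex.exp_add]
  congr 1
  have h1 : Complex.exp (↑u + ↑y * Complex.I) = Complex.exp u * Complex.exp (Complex.I * y) := by
    rw [← Complex.exp_add]; ring_nf
  have h2 : Complex.exp (p * (↑u + ↑y * Complex.I)) =
      Complex.exp (u * p : ℝ) * Complex.exp (Complex.I * (p * y)) := by
    rw [← Complex.exp_add]; push_cast; ring_nf
  rw [h1, h2]; ring

lemma sdb_norm_L (p x y r : ℝ) : ‖sdbL p x y r‖ =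
    Real.exp (- (x * r * Real.sin y) - r ^ p * Real.cos (p * y)) := by
  unfold sdbL
  rw [norm_mul, Complex.norm_exp, Complex.norm_exp, ← Real.exp_add]
  congr 1
  have e1 : Complex.exp (Complex.I * y) = ⟨Real.cos y, Real.sin y⟩ := by
    rw [mul_comm, Complex.exp_mul_I]
    apply Complex.ext <;> simp [Complex.cos_ofReal_re, Complex.sin_ofReal_re,
      Complex.cos_ofReal_im, Complex.sin_ofReal_im]
  have e2 : Complex.exp (Complex.I * (p * y)) = ⟨Real.cos (p * y), Real.sin (p * y)⟩ := by
    rw [mul_comm, ← Complex.ofReal_mul, Complex.exp_mul_I]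
    apply Complex.ext <;> simp only [Complex.add_re, Complex.add_im, Complex.mul_re, Complex.mul_im, Complex.I_re, Complex.I_im, Complex.cos_ofReal_re, Complex.sin_ofReal_re,
      Complex.cos_ofReal_im, Complex.sin_ofReal_im] <;> ring
  rw [e1, e2]
  simp

lemma sdb_cont_L (p x y : ℝ) (hp : 0 < p) : Continuous (sdbL p x y) := by
  have : Continuous fun r : ℝ => r ^ p := continuous_id.rpow_const (fun _ => Or.inr hp.le)
  unfold sdbL
  fun_prop

lemma sdb_cos_ge {p : ℝ} (hp : 0 < p) (hp2 : p < 2) {y : ℝ} (h0 : 0 ≤ y) (h1 : y ≤ Real.pi / 4) :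
    Real.cos (p * (Real.pi / 4)) ≤ Real.cos (p * y) := by
  apply Real.cos_le_cos_of_nonneg_of_le_pi (by positivity)
  · nlinarith [Real.pi_pos]
  · gcongr

lemma sdb_cos_pos {p : ℝ} (hp : 0 < p) (hp2 : p < 2) : 0 < Real.cos (p * (Real.pi / 4)) := by
  apply Real.cos_pos_of_mem_Ioo
  constructor <;> nlinarith [Real.pi_pos]

lemma sdb_norm_L_le {p x y r : ℝ} (hp : 0 < p) (hp2 : p < 2) (hx : 0 ≤ x) (h0 : 0 ≤ y)
    (h1 : y ≤ Real.pi / 4) (hr : 0 ≤ r) :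
    ‖sdbL p x y r‖ ≤ Real.exp (- Real.cos (p * (Real.pi / 4)) * r ^ p) := by
  rw [sdb_norm_L]
  apply Real.exp_le_exp.2
  have a := mul_le_mul_of_nonneg_left (sdb_cos_ge hp hp2 h0 h1) (Real.rpow_nonneg hr p)
  have b : 0 ≤ x * r * Real.sin y :=
    mul_nonneg (by positivity) (Real.sin_nonneg_of_nonneg_of_le_pi h0 (by linarith [Real.pi_pos]))
  linarith

lemma sdb_int_L {p x y : ℝ} (hp : 0 < p) (hp2 : p < 2) (hx : 0 ≤ x) (h0 : 0 ≤ y)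
    (h1 : y ≤ Real.pi / 4) : IntegrableOn (sdbL p x y) (Set.Ioi 0) := by
  have := integrableOn_rpow_mul_exp_neg_mul_rpow (p := p) (s := 0) (by norm_num) hp
    (sdb_cos_pos hp hp2)
  refine Integrable.mono' this (sdb_cont_L p x y hp).aestronglyMeasurable ?_
  filter_upwards [ae_restrict_mem measurableSet_Ioi] with r hr
  simpa using sdb_norm_L_le hp hp2 hx h0 h1 (le_of_lt hr)

lemma sdb_exp_image : Real.exp '' Set.univ = Set.Ioi 0 := by
  rw [Set.image_univ, Real.range_exp]

lemma sdb_change (f : ℝ → ℂ) :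
    ∫ r in Set.Ioi (0:ℝ), f r = ∫ u : ℝ, Real.exp u • f (Real.exp u) := by
  have := integral_image_eq_integral_abs_deriv_smul (s := Set.univ) MeasurableSet.univ
    (fun x _ => (Real.hasDerivAt_exp x).hasDerivWithinAt) Real.exp_injective.injOn f
  simpa [sdb_exp_image, abs_of_pos (Real.exp_pos _)] using this

lemma sdb_change_int {f : ℝ → ℂ} (hf : IntegrableOn f (Set.Ioi 0)) :
    Integrable (fun u : ℝ => Real.exp u • f (Real.exp u)) := by
  have := integrableOn_image_iff_integrableOn_abs_deriv_smul (s := Set.univ) MeasurableSet.univ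
    (fun x _ => (Real.hasDerivAt_exp x).hasDerivWithinAt) Real.exp_injective.injOn f
  rw [sdb_exp_image] at this
  simpa [abs_of_pos (Real.exp_pos _)] using this.1 hf

open Filter Topology in
lemma sdb_vert {p x : ℝ} (hp : 0 < p) (hp2 : p < 2) (hx : 0 ≤ x) {R : ℝ → ℝ} {l : Filter ℝ}
    (hl : Tendsto (fun u => Real.exp (R u) * Real.exp (- Real.cos (p * (Real.pi / 4)) * Real.exp (R u) ^ p)) l (𝓝 0)) :
    Tendsto (fun u => ∫ y in (0:ℝ)..(Real.pi/4), sdbG p x (R u + y * Complex.I)) l (𝓝 0) := by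
  have h4 : 0 ≤ Real.pi / 4 := by positivity
  apply squeeze_zero_norm (a := fun u => (Real.exp (R u) * Real.exp (- Real.cos (p * (Real.pi / 4)) * Real.exp (R u) ^ p)) * |Real.pi/4 - 0|)
  · intro u
    apply intervalIntegral.norm_integral_le_of_norm_le_const
    intro y hy
    rw [Set.uIoc_of_le h4] at hy
    rw [sdb_G_eq, norm_smul, Real.norm_eq_abs, abs_of_pos (Real.exp_pos _)]
    gcongr
    exact sdb_norm_L_le hp hp2 hx hy.1.le hy.2 (Real.exp_pos _).le
  · simpa using hl.mul_const _

open Filter Topology in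
lemma sdb_rotate {p x : ℝ} (hp : 0 < p) (hp2 : p < 2) (hx : 0 ≤ x) :
    ∫ r in Set.Ioi (0:ℝ), sdbL p x 0 r = ∫ r in Set.Ioi (0:ℝ), sdbL p x (Real.pi/4) r := by
  have h4 : 0 ≤ Real.pi / 4 := by positivity
  have hc := sdb_cos_pos hp hp2
  set c := Real.cos (p * (Real.pi / 4)) with hcdef
  have base : Tendsto (fun r : ℝ => r * Real.exp (- c * r ^ p)) atTop (𝓝 0) := by
    have := (tendsto_rpow_mul_exp_neg_mul_atTop_nhds_zero (1/p) c hc).comp (tendsto_rpow_atTop hp)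
    refine this.congr' ?_
    filter_upwards [eventually_gt_atTop 0] with r hr
    simp only [Function.comp]
    rw [← Real.rpow_mul hr.le, mul_one_div_cancel hp.ne', Real.rpow_one]
  have base0 : Tendsto (fun r : ℝ => r * Real.exp (- c * r ^ p)) (𝓝 0) (𝓝 0) := by
    have : Continuous fun r : ℝ => r ^ p := continuous_id.rpow_const (fun _ => Or.inr hp.le)
    have h : Continuous fun r : ℝ => r * Real.exp (- c * r ^ p) := by fun_prop
    simpa using h.tendsto 0
  have v1 := sdb_vert hp hp2 hx (R := fun u => u) (l := atTop) (base.comp Real.tendsto_exp_atTop)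
  have v2 := sdb_vert hp hp2 hx (R := fun u => -u) (l := atTop)
    (base0.comp (Real.tendsto_exp_atBot.comp tendsto_neg_atTop_atBot))
  rw [sdb_change, sdb_change]
  have i1 := intervalIntegral_tendsto_integral (sdb_change_int (sdb_int_L hp hp2 hx le_rfl h4))
    tendsto_neg_atTop_atBot tendsto_id
  have i2 := intervalIntegral_tendsto_integral (sdb_change_int (sdb_int_L hp hp2 hx h4 le_rfl))
    tendsto_neg_atTop_atBot tendsto_id
  have key : ∀ R : ℝ, (((∫ u in (-R)..R, Real.exp u • sdbL p x 0 (Real.exp u)) -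
      (∫ u in (-R)..R, Real.exp u • sdbL p x (Real.pi/4) (Real.exp u))) +
      Complex.I • (∫ y in (0:ℝ)..(Real.pi/4), sdbG p x (R + y * Complex.I))) -
      Complex.I • (∫ y in (0:ℝ)..(Real.pi/4), sdbG p x ((-R : ℝ) + y * Complex.I)) = 0 := by
    intro R
    have hd : Differentiable ℂ (sdbG p x) := by unfold sdbG; fun_prop
    have := Complex.integral_boundary_rect_eq_zero_of_differentiableOn (sdbG p x)
      (-R : ℝ) (R + (Real.pi/4 : ℝ) * Complex.I) hd.differentiableOn
    simp only [← sdb_G_eq]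
    simpa using this
  have lim := ((i1.sub i2).add (v1.const_smul Complex.I)).sub (v2.const_smul Complex.I)
  have lim2 := tendsto_nhds_unique lim (by
    refine Tendsto.congr (fun R => (key R).symm) tendsto_const_nhds)
  simp only [smul_zero, add_zero, sub_zero] at lim2
  exact sub_eq_zero.1 lim2

lemma sdb_key {p x : ℝ} (hp : 0 < p) (hp2 : p < 2) (hx : 0 < x) :
    |(∫ r in Set.Ioi (0:ℝ), sdbL p x 0 r).re| ≤
      2 * ((1 / (x * Real.sin (Real.pi/4))) ^ (p+1) * Real.Gamma (p+1)) := by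
  rw [sdb_rotate hp hp2 hx.le]
  have h4 : 0 ≤ Real.pi / 4 := by positivity
  have hs : 0 < Real.sin (Real.pi/4) := Real.sin_pos_of_pos_of_lt_pi (by positivity) (by linarith [Real.pi_pos])
  set e := Complex.exp (Complex.I * (Real.pi/4 : ℝ)) with he
  have ere : (Complex.I * x * e).re = - (x * Real.sin (Real.pi/4)) := by
    rw [he, mul_comm Complex.I ((Real.pi/4 : ℝ) : ℂ)]
    simp [Complex.exp_re, Complex.exp_im]
  have hneg : (Complex.I * x * e).re < 0 := by rw [ere]; linarith [mul_pos hx hs]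
  have K := integral_exp_mul_complex_Ioi hneg 0
  have Ki := (integrableOn_exp_mul_complex_Ioi hneg 0).const_mul e
  have e0 : e ≠ 0 := Complex.exp_ne_zero _
  have Kre : (∫ r in Set.Ioi (0:ℝ), e * Complex.exp (Complex.I * x * e * r)).re = 0 := by
    rw [integral_const_mul, K]
    have : e * (-Complex.exp (Complex.I * x * e * (0:ℝ)) / (Complex.I * x * e)) = Complex.I * ((1 / x : ℝ) : ℂ) := by
      have : (x:ℂ) ≠ 0 := by exact_mod_cast hx.ne'
      push_cast
      simp only [mul_zero, Complex.exp_zero]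
      field_simp
      simp
    rw [this, mul_comm, Complex.re_ofReal_mul]; simp
  have : (∫ r in Set.Ioi (0:ℝ), sdbL p x (Real.pi/4) r).re =
      (∫ r in Set.Ioi (0:ℝ), (sdbL p x (Real.pi/4) r - e * Complex.exp (Complex.I * x * e * r))).re := by
    rw [integral_sub (sdb_int_L hp hp2 hx.le h4 le_rfl) Ki, Complex.sub_re, Kre, sub_zero]
  rw [this, ← Real.integral_rpow_mul_exp_neg_mul_Ioi (by linarith) (by positivity), ← integral_const_mul]
  refine (Complex.abs_re_le_norm _).trans ?_
  apply norm_integral_le_of_norm_le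
  · have := (integrableOn_rpow_mul_exp_neg_mul_rpow (p := 1) (s := p + 1 - 1) (b := x * Real.sin (Real.pi/4)) (by linarith) one_pos (by positivity)).const_mul 2
    simpa using this
  · filter_upwards [ae_restrict_mem measurableSet_Ioi] with r hr
    have hr : 0 < r := hr
    have fac : sdbL p x (Real.pi/4) r - e * Complex.exp (Complex.I * x * e * r) =
        e * Complex.exp (Complex.I * x * e * r) *
         (Complex.exp (- ((r ^ p : ℝ) * Complex.exp (Complex.I * (p * (Real.pi/4 : ℝ))))) - 1) := by
      unfold sdbL
      rw [sub_eq_add_neg (Complex.I * x * r * _), Complex.exp_add, ← he]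
      ring_nf
    rw [fac, norm_mul, norm_mul, he, Complex.norm_exp_I_mul_ofReal, ← he, Complex.norm_exp,
      Complex.re_mul_ofReal, ere, add_sub_cancel_right, one_mul]
    have n2 : ‖Complex.exp (Complex.I * (p * (Real.pi/4 : ℝ)))‖ = 1 := by
      rw [← Complex.ofReal_mul, Complex.norm_exp_I_mul_ofReal]
    have b := sdb_exp_sub_one (z := - ((r ^ p : ℝ) * Complex.exp (Complex.I * (p * (Real.pi/4 : ℝ))))) (by
      rw [Complex.neg_re, Complex.re_ofReal_mul, ← Complex.ofReal_mul, mul_comm Complex.I,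
        Complex.exp_ofReal_mul_I_re]
      have := sdb_cos_pos hp hp2
      have := Real.rpow_nonneg hr.le p
      simp only [Left.neg_nonpos_iff]; positivity)
    rw [norm_neg, norm_mul, n2, mul_one, Complex.norm_real, Real.norm_of_nonneg (Real.rpow_nonneg hr.le p)] at b
    calc _ ≤ Real.exp (-(x * Real.sin (Real.pi/4)) * r) * (2 * r ^ p) := by gcongr
      _ = _ := by ring_nf

lemma sdb_integrable_abs {p : ℝ} (hp : 0 < p) :
    Integrable (fun s : ℝ => Real.exp (-(|s| ^ p))) := by
  have h := integrableOn_rpow_mul_exp_neg_rpow (p := p) (s := 0) (by norm_num) hp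
  have h1 : IntegrableOn (fun s : ℝ => Real.exp (-(|s| ^ p))) (Set.Ioi 0) := by
    refine h.congr_fun (fun s hs => ?_) measurableSet_Ioi
    simp [abs_of_pos (show 0 < s from hs)]
  rw [← integrableOn_univ, ← Set.Iic_union_Ioi (a := (0:ℝ))]
  refine IntegrableOn.union ?_ h1
  rw [← neg_zero] at h1
  have h2 := h1.comp_neg_Iio
  simp only [abs_neg] at h2
  exact (integrableOn_Iic_iff_integrableOn_Iio (by simp)).2 h2

lemma sdb_integrable_full {p : ℝ} (hp : 0 < p) (x : ℝ) :
    Integrable (fun s : ℝ => Complex.exp (Complex.I * s * x) * (Real.exp (-(|s| ^ p)) : ℂ)) := by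
  refine (sdb_integrable_abs hp).mono' ?_ ?_
  · have : Continuous fun r : ℝ => |r| ^ p := continuous_abs.rpow_const (fun _ => Or.inr hp.le)
    apply Continuous.aestronglyMeasurable
    fun_prop
  · filter_upwards with s
    have : Complex.I * s * x = Complex.I * (s * x : ℝ) := by push_cast; ring
    rw [norm_mul, this, Complex.norm_exp_I_mul_ofReal, one_mul,
      Complex.norm_real, Real.norm_of_nonneg (Real.exp_pos _).le]

lemma sdb_L_zero (p x s : ℝ) (hs : 0 < s) : sdbL p x 0 s =
    Complex.exp (Complex.I * s * x) * (Real.exp (-(|s| ^ p)) : ℂ) := by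
  unfold sdbL
  rw [abs_of_pos hs]
  push_cast
  simp only [mul_zero, Complex.exp_zero, one_mul, mul_one]
  rw [← Complex.exp_add]
  ring_nf

lemma sdb_full {p : ℝ} (hp : 0 < p) (x : ℝ) :
    ∫ s : ℝ, Complex.exp (Complex.I * s * x) * (Real.exp (-(|s| ^ p)) : ℂ) =
      (2 * (∫ r in Set.Ioi (0:ℝ), sdbL p x 0 r).re : ℝ) := by
  have hi := sdb_integrable_full hp x
  rw [← intervalIntegral.integral_Iic_add_Ioi (b := (0:ℝ)) hi.integrableOn hi.integrableOn]
  have h1 : ∫ s in Set.Ioi (0:ℝ), Complex.exp (Complex.I * s * x) * (Real.exp (-(|s| ^ p)) : ℂ) =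
      ∫ r in Set.Ioi (0:ℝ), sdbL p x 0 r :=
    setIntegral_congr_fun measurableSet_Ioi (fun s hs => (sdb_L_zero p x s hs).symm)
  have h2 : ∫ s in Set.Iic (0:ℝ), Complex.exp (Complex.I * s * x) * (Real.exp (-(|s| ^ p)) : ℂ) =
      (starRingEnd ℂ) (∫ r in Set.Ioi (0:ℝ), sdbL p x 0 r) := by
    rw [← integral_conj]
    have := integral_comp_neg_Ioi (0:ℝ)
      (fun s : ℝ => Complex.exp (Complex.I * s * x) * (Real.exp (-(|s| ^ p)) : ℂ))
    rw [neg_zero] at this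
    rw [← this]
    refine setIntegral_congr_fun measurableSet_Ioi (fun s hs => ?_)
    rw [sdb_L_zero p x s hs, map_mul, ← Complex.exp_conj, Complex.conj_ofReal, abs_neg]
    congr 2
    simp
  rw [h1, h2, add_comm, Complex.add_conj]

open FourierTransform in
lemma sdb_inversion (p : ℝ) (hp : 0 < p)
    (μ : Measure ℝ) [IsProbabilityMeasure μ]
    (hchar : ∀ s : ℝ, ∫ x, Complex.exp (Complex.I * s * x) ∂μ
      = (Real.exp (-(|s| ^ p)) : ℂ))
    (φ : ℝ → ℝ) (hφc : Continuous φ) (hφ0 : ∀ x, 0 ≤ φ x)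
    (hdens : μ = volume.withDensity (fun x => ENNReal.ofReal (φ x))) (x : ℝ) :
    φ x = (1 / Real.pi) * (∫ r in Set.Ioi (0:ℝ), sdbL p x 0 r).re := by
  have hint : Integrable φ := by
    refine ⟨hφc.aestronglyMeasurable, ?_⟩
    rw [hasFiniteIntegral_iff_ofReal (Filter.Eventually.of_forall hφ0)]
    have : μ Set.univ = ∫⁻ x, ENNReal.ofReal (φ x) := by
      rw [hdens, withDensity_apply _ MeasurableSet.univ, Measure.restrict_univ]
    rw [← this]; exact measure_lt_top _ _
  set f : ℝ → ℂ := fun x => (φ x : ℂ) with hf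
  have hfi : Integrable f := hint.ofReal
  have hF : 𝓕 f = fun v : ℝ => (Real.exp (-(|2 * Real.pi * v| ^ p)) : ℂ) := by
    funext v
    rw [Real.fourier_real_eq_integral_exp_smul]
    have := hchar (-(2 * Real.pi * v))
    rw [abs_neg] at this
    rw [← this, hdens, integral_withDensity_eq_integral_toReal_smul (by fun_prop) (by simp)]
    congr 1
    funext y
    rw [ENNReal.toReal_ofReal (hφ0 y), Complex.real_smul, smul_eq_mul, mul_comm]
    congr 2
    push_cast; ring
  have hFi : Integrable (𝓕 f) := by
    rw [hF]
    have := ((sdb_integrable_abs hp).comp_mul_left' (R := 2 * Real.pi) (by positivity)).ofReal (𝕜 := ℂ)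
    simpa using this
  have inv := hfi.fourierInv_fourier_eq hFi (v := x) (by fun_prop)
  rw [Real.fourierInv_eq', hF] at inv
  have sub := Measure.integral_comp_mul_left (fun s : ℝ => Complex.exp (Complex.I * s * x) * (Real.exp (-(|s| ^ p)) : ℂ)) (2 * Real.pi)
  have e : (∫ v : ℝ, Complex.exp (↑(2 * Real.pi * inner ℝ v x) * Complex.I) • (Real.exp (-(|2 * Real.pi * v| ^ p)) : ℂ)) = ∫ v : ℝ, Complex.exp (Complex.I * (2 * Real.pi * v : ℝ) * x) * (Real.exp (-(|2 * Real.pi * v| ^ p)) : ℂ) := by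
    congr 1
    funext v
    rw [smul_eq_mul]
    congr 2
    simp; ring
  rw [e, sub, sdb_full hp, abs_of_pos (by positivity), Complex.real_smul] at inv
  have : (((2 * Real.pi)⁻¹ * (2 * (∫ r in Set.Ioi (0:ℝ), sdbL p x 0 r).re) : ℝ) : ℂ) = (φ x : ℂ) := by
    rw [← hf] at *
    push_cast at inv ⊢
    exact inv
  rw [← Complex.ofReal_injective this]
  have := Real.pi_pos
  field_simp

theorem stable_density_bounds (p : ℝ) (hp : 0 < p) (hp2 : p < 2)
    (μ : Measure ℝ) [IsProbabilityMeasure μ]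
    (hchar : ∀ s : ℝ, ∫ x, Complex.exp (Complex.I * s * x) ∂μ
      = (Real.exp (-(|s| ^ p)) : ℂ))
    (φ : ℝ → ℝ) (hφc : Continuous φ) (hφ0 : ∀ x, 0 ≤ φ x)
    (hdens : μ = volume.withDensity (fun x => ENNReal.ofReal (φ x))) :
    (∃ C : ℝ, 0 < C ∧
      (∀ x : ℝ, 1 ≤ x → 1 - (μ (Set.Iic x)).toReal ≤ C * x ^ (-p)) ∧
      (∀ x : ℝ, φ x ≤ C / (1 + |x| ^ (p + 1)))) ∧
    ∀ x : ℝ, φ (-x) = φ x := by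
  have hinv := sdb_inversion p hp μ hchar φ hφc hφ0 hdens
  have heven : ∀ x, φ (-x) = φ x := by
    intro x
    rw [hinv x, hinv (-x)]
    congr 1
    rw [← Complex.conj_re (∫ r in Set.Ioi (0:ℝ), sdbL p x 0 r), ← integral_conj]
    congr 1
    refine setIntegral_congr_fun measurableSet_Ioi (fun s hs => ?_)
    rw [sdb_L_zero p x s hs, sdb_L_zero p (-x) s hs, map_mul, ← Complex.exp_conj,
      Complex.conj_ofReal]
    congr 2
    simp
  refine ⟨?_, heven⟩
  have hs : 0 < Real.sin (Real.pi/4) :=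
    Real.sin_pos_of_pos_of_lt_pi (by positivity) (by linarith [Real.pi_pos])
  obtain ⟨A, hA, hdec⟩ : ∃ A : ℝ, 0 < A ∧ ∀ x : ℝ, 0 < x → φ x ≤ A * x ^ (-(p + 1)) := by
    refine ⟨1 / Real.pi * (2 * ((1 / Real.sin (Real.pi/4)) ^ (p+1) * Real.Gamma (p+1))), ?_, ?_⟩
    · have := Real.Gamma_pos_of_pos (show 0 < p + 1 by linarith)
      have := Real.pi_pos
      positivity
    · intro x hx
      have k := (le_abs_self _).trans (sdb_key hp hp2 hx)
      have e : (1 / (x * Real.sin (Real.pi/4))) ^ (p+1) =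
          (1 / Real.sin (Real.pi/4)) ^ (p+1) * x ^ (-(p+1)) := by
        rw [Real.rpow_neg hx.le, ← Real.inv_rpow hx.le, ← Real.mul_rpow (by positivity) (by positivity)]
        congr 1
        field_simp
      rw [e] at k
      rw [hinv x]
      calc _ ≤ _ := mul_le_mul_of_nonneg_left k (by positivity)
        _ = _ := by ring
  obtain ⟨M, hM⟩ := (isCompact_Icc (a := (0:ℝ)) (b := 1)).exists_bound_of_continuousOn hφc.continuousOn
  have hpos : ∀ x : ℝ, 0 ≤ x → φ x ≤ (2 * (A + |M|)) / (1 + x ^ (p + 1)) := by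
    intro x hx
    have hxp : 0 ≤ x ^ (p + 1) := Real.rpow_nonneg hx _
    rw [le_div_iff₀ (by positivity)]
    rcases le_total x 1 with h | h
    · have h1 : x ^ (p+1) ≤ 1 := Real.rpow_le_one hx h (by linarith)
      have h2 := (le_abs_self _).trans ((hM x ⟨hx, h⟩).trans (le_abs_self M))
      nlinarith [hφ0 x, abs_nonneg M]
    · have h1 : 1 ≤ x ^ (p+1) := Real.one_le_rpow h (by linarith)
      have h2 := hdec x (by linarith)
      rw [Real.rpow_neg hx, ← div_eq_mul_inv, le_div_iff₀ (by linarith)] at h2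
      nlinarith [hφ0 x, abs_nonneg M]
  refine ⟨2 * (A + |M|) + A / p, by positivity, ?_, ?_⟩
  · intro x hx
    have hx0 : 0 < x := by linarith
    have hm : 1 - (μ (Set.Iic x)).toReal = (μ (Set.Ioi x)).toReal := by
      have := probReal_compl_eq_one_sub (μ := μ) (s := Set.Iic x) measurableSet_Iic
      rw [Set.compl_Iic] at this
      exact this.symm
    have hxp : 0 ≤ x ^ (-p) := Real.rpow_nonneg hx0.le _
    have hII := integrableOn_Ioi_rpow_of_lt (show -(p+1) < -1 by linarith) hx0
    have hb : μ (Set.Ioi x) ≤ ENNReal.ofReal (A / p * x ^ (-p)) := by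
      rw [hdens, withDensity_apply _ measurableSet_Ioi]
      calc _ ≤ ∫⁻ t in Set.Ioi x, ENNReal.ofReal (A * t ^ (-(p+1))) := by
            refine setLIntegral_mono' measurableSet_Ioi (fun t ht => ?_)
            exact ENNReal.ofReal_le_ofReal (hdec t (hx0.trans ht))
        _ = ENNReal.ofReal (∫ t in Set.Ioi x, A * t ^ (-(p+1))) := by
            rw [ofReal_integral_eq_lintegral_ofReal (hII.const_mul A)]
            filter_upwards [ae_restrict_mem measurableSet_Ioi] with t ht
            have : 0 ≤ t ^ (-(p+1)) := Real.rpow_nonneg (hx0.trans ht).le _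
            show 0 ≤ A * t ^ (-(p+1))
            positivity
        _ = _ := by
            rw [integral_const_mul, integral_Ioi_rpow_of_lt (by linarith) hx0]
            congr 1
            have : -(p+1) + 1 = -p := by ring
            rw [this]
            field_simp
    rw [hm]
    calc _ ≤ A / p * x ^ (-p) := ENNReal.toReal_le_of_le_ofReal (by positivity) hb
      _ ≤ _ := by
        apply mul_le_mul_of_nonneg_right _ hxp
        have := abs_nonneg M
        linarith
  · intro x
    have h : φ x = φ |x| := by
      rcases abs_cases x with ⟨h, _⟩ | ⟨h, _⟩ <;> rw [h]
      exact (heven x).symm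
    rw [h]
    refine (hpos |x| (abs_nonneg x)).trans ?_
    have : 0 ≤ |x| ^ (p+1) := Real.rpow_nonneg (abs_nonneg x) _
    gcongr
    have : 0 < A / p := by positivity
    linarith
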